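/- Let 𝔮 be a finite-dimensional Lie algebra, 𝔞 ⊲ 𝔮 an abelian ideal, β ∈ 𝔮*, γ = β|_𝔞 ∈ 𝔞*, and β̌ = β|_{𝔮_γ}. Then (𝔮_γ)_{β̌} = 𝔮_β + 𝔞, where 𝔮_γ = {x ∈ 𝔮 : γ([x,a]) = 0 for all a ∈ 𝔞} is the stabiliser of γ for the action of 𝔮 on 𝔞*, 𝔮_β = {x ∈ 𝔮 : β([x,y]) = 0 for all y ∈ 𝔮}, and (𝔮_γ)_{β̌} = {x ∈ 𝔮_γ : β([x,y]) = 0 for all y ∈ 𝔮_γ}. -/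

import Mathlib

/-!
Statement 9 (Lemma `restriction` in the paper):
Let `𝔮` be a finite-dimensional complex Lie algebra, `𝔞 ⊲ 𝔮` an abelian ideal, `β ∈ 𝔮*`,
`γ = β|𝔞` and `β̌ = β|_{𝔮_γ}`.  Then `(𝔮_γ)_{β̌} = 𝔮_β + 𝔞`, where
`𝔮_γ = {x ∈ 𝔮 | γ([x,a]) = 0 ∀ a ∈ 𝔞}`, `𝔮_β = {x | β([x,y]) = 0 ∀ y}` and
`(𝔮_γ)_{β̌} = {x ∈ 𝔮_γ | β([x,y]) = 0 ∀ y ∈ 𝔮_γ}`.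
-/

open Module

variable {𝔮 : Type*} [LieRing 𝔮] [LieAlgebra ℂ 𝔮]

/-- The stabiliser `𝔮_γ ⊆ 𝔮` of (the restriction to the ideal `𝔞` of) a linear form `β`,
for the action of `𝔮` on `𝔞*`; the form `γ = β|𝔞` only enters through its values on `𝔞`. -/
def idealStabilizer (𝔞 : LieIdeal ℂ 𝔮) (β : Module.Dual ℂ 𝔮) : Submodule ℂ 𝔮 where
  carrier := {x | ∀ a ∈ 𝔞, β ⁅x, a⁆ = 0}
  add_mem' := fun {x y} hx hy a ha => by rw [add_lie, map_add, hx a ha, hy a ha, add_zero]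
  zero_mem' := fun a _ => by rw [zero_lie, map_zero]
  smul_mem' := fun c x hx a ha => by rw [smul_lie, map_smul, hx a ha, smul_zero]

/-- The coadjoint stabiliser `𝔮_β` of a linear form `β ∈ 𝔮*`. -/
def coadStabilizer (β : Module.Dual ℂ 𝔮) : Submodule ℂ 𝔮 where
  carrier := {x | ∀ y : 𝔮, β ⁅x, y⁆ = 0}
  add_mem' := fun {x y} hx hy a => by rw [add_lie, map_add, hx a, hy a, add_zero]
  zero_mem' := fun a => by rw [zero_lie, map_zero]
  smul_mem' := fun c x hx a => by rw [smul_lie, map_smul, hx a, smul_zero]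

/-- The stabiliser `(𝔮_γ)_{β̌}` of the restriction `β̌` of `β` to `𝔮_γ`. -/
def relStabilizer (𝔞 : LieIdeal ℂ 𝔮) (β : Module.Dual ℂ 𝔮) : Submodule ℂ 𝔮 where
  carrier := {x | x ∈ idealStabilizer 𝔞 β ∧ ∀ y ∈ idealStabilizer 𝔞 β, β ⁅x, y⁆ = 0}
  add_mem' := fun {x y} hx hy =>
    ⟨(idealStabilizer 𝔞 β).add_mem hx.1 hy.1, fun a ha => by
      rw [add_lie, map_add, hx.2 a ha, hy.2 a ha, add_zero]⟩
  zero_mem' := ⟨(idealStabilizer 𝔞 β).zero_mem, fun a _ => by rw [zero_lie, map_zero]⟩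
  smul_mem' := fun c x hx =>
    ⟨(idealStabilizer 𝔞 β).smul_mem c hx.1, fun a ha => by
      rw [smul_lie, map_smul, hx.2 a ha, smul_zero]⟩

/-- The skew-symmetric form `(x, y) ↦ β ⁅x, y⁆` attached to a linear form `β`. -/
def lieForm (β : Module.Dual ℂ 𝔮) : 𝔮 →ₗ[ℂ] Module.Dual ℂ 𝔮 :=
  (LieModule.toEnd ℂ 𝔮 𝔮 : 𝔮 →ₗ[ℂ] Module.End ℂ 𝔮).compr₂ β

theorem lieForm_apply (β : Module.Dual ℂ 𝔮) (x y : 𝔮) : lieForm β x y = β ⁅x, y⁆ := rfl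

theorem apply_lie_eq_zero_comm (β : Module.Dual ℂ 𝔮) {x y : 𝔮} :
    β ⁅x, y⁆ = 0 ↔ β ⁅y, x⁆ = 0 := by
  rw [← lie_skew, map_neg, neg_eq_zero]

theorem idealStabilizer_eq_dualCoannihilator (𝔞 : LieIdeal ℂ 𝔮) (β : Module.Dual ℂ 𝔮) :
    idealStabilizer 𝔞 β =
      ((𝔞 : Submodule ℂ 𝔮).map (lieForm β)).dualCoannihilator := by
  ext y
  simp only [Submodule.mem_dualCoannihilator, Submodule.mem_map, forall_exists_index, and_imp,
    forall_apply_eq_imp_iff₂, lieForm_apply]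
  exact forall₂_congr fun _ _ => apply_lie_eq_zero_comm β

/-- For an abelian ideal `𝔞` of a finite-dimensional complex Lie algebra `𝔮`
and a linear form `β ∈ 𝔮*`, with `γ := β|𝔞` and `β̌ := β|_{𝔮_γ}`, one has
`(𝔮_γ)_{β̌} = 𝔮_β + 𝔞`. -/
theorem stmt9 [FiniteDimensional ℂ 𝔮] (𝔞 : LieIdeal ℂ 𝔮)
    (hab : ∀ a ∈ 𝔞, ∀ b ∈ 𝔞, ⁅a, b⁆ = (0 : 𝔮))
    (β : Module.Dual ℂ 𝔮) :
    relStabilizer 𝔞 β = coadStabilizer β ⊔ (𝔞 : Submodule ℂ 𝔮) := by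
  apply le_antisymm
  · rintro x ⟨-, hx⟩
    have hmem : lieForm β x ∈ (idealStabilizer 𝔞 β).dualAnnihilator :=
      (Submodule.mem_dualAnnihilator _).2 hx
    rw [idealStabilizer_eq_dualCoannihilator,
      Subspace.dualCoannihilator_dualAnnihilator_eq] at hmem
    obtain ⟨a, ha, hax⟩ := hmem
    refine Submodule.mem_sup.2 ⟨x - a, fun y => ?_, a, ha, sub_add_cancel x a⟩
    rw [← lieForm_apply, map_sub, hax, sub_self, LinearMap.zero_apply]
  · refine sup_le (fun x hx => ⟨fun a _ => hx a, fun y _ => hx y⟩)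
      fun a ha => ⟨fun b hb => ?_, fun y hy => ?_⟩
    · rw [hab a ha b hb, map_zero]
    · exact (apply_lie_eq_zero_comm β).1 (hy a ha)
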